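/- For any tripartite density matrix ρ_ABC, the convoluted metric satisfies the triangle inequality: M_AB + M_BC ≥ M_AC, where for each pair of subsystems X, Y among {A, B, C}, M_XY := 2S(ρ_XY) + S(ρ_XZ) + S(ρ_YZ) − S(ρ_X) − S(ρ_Y) − 2S(ρ_ABC) with Z the remaining subsystem. -/

import Mathlib

open Matrix
open scoped ComplexOrder

noncomputable section

/-- The von Neumann entropy of a matrix: `S(ρ) = -∑ᵢ λᵢ log λᵢ` where `λᵢ` are the
eigenvalues of `ρ` (defined for Hermitian matrices; `0` otherwise, and with the
convention `0 log 0 = 0` built into `Real.log 0 = 0`). -/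
def vN {n : Type*} [Fintype n] [DecidableEq n] (ρ : Matrix n n ℂ) : ℝ :=
  if h : ρ.IsHermitian then -∑ i, h.eigenvalues i * Real.log (h.eigenvalues i) else 0

/-- A density matrix: positive semidefinite with unit trace. -/
def IsDensityMatrix {n : Type*} [Fintype n] (ρ : Matrix n n ℂ) : Prop :=
  ρ.PosSemidef ∧ ρ.trace = 1

section Tripartite

variable {A B C : Type*} [Fintype A] [Fintype B] [Fintype C]
  [DecidableEq A] [DecidableEq B] [DecidableEq C]

/-- Reduced density matrix `ρ_AB` (partial trace over `C`). -/
def rAB (ρ : Matrix (A × B × C) (A × B × C) ℂ) : Matrix (A × B) (A × B) ℂ :=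
  fun x y => ∑ c : C, ρ (x.1, x.2, c) (y.1, y.2, c)

/-- Reduced density matrix `ρ_AC` (partial trace over `B`). -/
def rAC (ρ : Matrix (A × B × C) (A × B × C) ℂ) : Matrix (A × C) (A × C) ℂ :=
  fun x y => ∑ b : B, ρ (x.1, b, x.2) (y.1, b, y.2)

/-- Reduced density matrix `ρ_BC` (partial trace over `A`). -/
def rBC (ρ : Matrix (A × B × C) (A × B × C) ℂ) : Matrix (B × C) (B × C) ℂ :=
  fun x y => ∑ a : A, ρ (a, x.1, x.2) (a, y.1, y.2)

/-- Reduced density matrix `ρ_A` (partial trace over `B` and `C`). -/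
def rA (ρ : Matrix (A × B × C) (A × B × C) ℂ) : Matrix A A ℂ :=
  fun a a' => ∑ b : B, ∑ c : C, ρ (a, b, c) (a', b, c)

/-- Reduced density matrix `ρ_B` (partial trace over `A` and `C`). -/
def rB (ρ : Matrix (A × B × C) (A × B × C) ℂ) : Matrix B B ℂ :=
  fun b b' => ∑ a : A, ∑ c : C, ρ (a, b, c) (a, b', c)

/-- Reduced density matrix `ρ_C` (partial trace over `A` and `B`). -/
def rC (ρ : Matrix (A × B × C) (A × B × C) ℂ) : Matrix C C ℂ :=
  fun c c' => ∑ a : A, ∑ b : B, ρ (a, b, c) (a, b, c')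

end Tripartite
namespace SSA

open Kronecker Filter Topology

/-- The variational functional whose supremum over `Z` gives the resolvent form of the relative
entropy. -/
def Phi {n : Type*} [Fintype n] (ρ σ : Matrix n n ℂ) (t : ℝ) (Z : Matrix n n ℂ) : ℝ :=
  2 * (ρ * Z).trace.re - (σ * (Z * Zᴴ)).trace.re - t * (ρ * (Zᴴ * Z)).trace.re

lemma Phi_diag {n : Type*} [Fintype n] [DecidableEq n] (U V : Matrix n n ℂ) (p q : n → ℝ)
    (hU : Uᴴ * U = 1) (hV : Vᴴ * V = 1) (t : ℝ) (Y : Matrix n n ℂ) :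
    Phi (U * diagonal (fun i => (p i : ℂ)) * Uᴴ) (V * diagonal (fun i => (q i : ℂ)) * Vᴴ) t
      (V * Y * Uᴴ) =
    ∑ j, ∑ i, (2 * p i * (star ((Vᴴ * U) j i) * Y j i).re
      - (q j + t * p i) * Complex.normSq (Y j i)) := by
  have e1 : (U * diagonal (fun i => (p i : ℂ)) * Uᴴ * (V * Y * Uᴴ)).trace
      = (diagonal (fun i => (p i : ℂ)) * ((Vᴴ * U)ᴴ * Y)).trace := by
    have : U * diagonal (fun i => (p i : ℂ)) * Uᴴ * (V * Y * Uᴴ)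
      = U * (diagonal (fun i => (p i : ℂ)) * ((Vᴴ * U)ᴴ * Y) * Uᴴ) := by
      simp only [conjTranspose_mul, conjTranspose_conjTranspose, Matrix.mul_assoc]
    rw [this, trace_mul_comm, Matrix.mul_assoc, hU, Matrix.mul_one]
  have e2 : (V * diagonal (fun i => (q i : ℂ)) * Vᴴ * ((V * Y * Uᴴ) * (V * Y * Uᴴ)ᴴ)).trace
      = (diagonal (fun i => (q i : ℂ)) * (Y * Yᴴ)).trace := by
    have : V * diagonal (fun i => (q i : ℂ)) * Vᴴ * ((V * Y * Uᴴ) * (V * Y * Uᴴ)ᴴ)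
      = V * (diagonal (fun i => (q i : ℂ)) * ((Vᴴ * V) * (Y * (Uᴴ * U) * Yᴴ)) * Vᴴ) := by
      simp only [conjTranspose_mul, conjTranspose_conjTranspose, Matrix.mul_assoc]
    rw [this, trace_mul_comm, Matrix.mul_assoc, hV, hU]
    simp only [Matrix.mul_one, Matrix.one_mul]
  have e3 : (U * diagonal (fun i => (p i : ℂ)) * Uᴴ * ((V * Y * Uᴴ)ᴴ * (V * Y * Uᴴ))).trace
      = (diagonal (fun i => (p i : ℂ)) * (Yᴴ * Y)).trace := by
    have : U * diagonal (fun i => (p i : ℂ)) * Uᴴ * ((V * Y * Uᴴ)ᴴ * (V * Y * Uᴴ))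
      = U * (diagonal (fun i => (p i : ℂ)) * ((Uᴴ * U) * (Yᴴ * (Vᴴ * V) * Y)) * Uᴴ) := by
      simp only [conjTranspose_mul, conjTranspose_conjTranspose, Matrix.mul_assoc]
    rw [this, trace_mul_comm, Matrix.mul_assoc, hV, hU]
    simp only [Matrix.mul_one, Matrix.one_mul]
  have f1 : (diagonal (fun i => (p i : ℂ)) * ((Vᴴ * U)ᴴ * Y)).trace.re
      = ∑ j, ∑ i, p i * (star ((Vᴴ * U) j i) * Y j i).re := by
    rw [Finset.sum_comm]
    simp only [Matrix.trace, diag_apply, diagonal_mul, Complex.re_sum, Complex.re_ofReal_mul]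
    refine Finset.sum_congr rfl fun i _ => ?_
    rw [Matrix.mul_apply, Complex.re_sum, Finset.mul_sum]
    rfl
  have f2 : (diagonal (fun i => (q i : ℂ)) * (Y * Yᴴ)).trace.re
      = ∑ j, ∑ i, q j * Complex.normSq (Y j i) := by
    simp only [Matrix.trace, diag_apply, diagonal_mul, Complex.re_sum, Complex.re_ofReal_mul]
    refine Finset.sum_congr rfl fun i _ => ?_
    rw [Matrix.mul_apply, Complex.re_sum, Finset.mul_sum]
    refine Finset.sum_congr rfl fun j _ => ?_
    rw [conjTranspose_apply, Complex.star_def, Complex.mul_conj, Complex.ofReal_re]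
  have f3 : (diagonal (fun i => (p i : ℂ)) * (Yᴴ * Y)).trace.re
      = ∑ j, ∑ i, p i * Complex.normSq (Y j i) := by
    rw [Finset.sum_comm]
    simp only [Matrix.trace, diag_apply, diagonal_mul, Complex.re_sum, Complex.re_ofReal_mul]
    refine Finset.sum_congr rfl fun i _ => ?_
    rw [Matrix.mul_apply, Complex.re_sum, Finset.mul_sum]
    refine Finset.sum_congr rfl fun j _ => ?_
    rw [conjTranspose_apply, Complex.star_def, mul_comm (starRingEnd ℂ _), Complex.mul_conj,
      Complex.ofReal_re]
  unfold Phi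
  rw [e1, e2, e3, f1, f2, f3]
  simp only [Finset.mul_sum, ← Finset.sum_sub_distrib]
  refine Finset.sum_congr rfl fun j _ => Finset.sum_congr rfl fun i _ => ?_
  ring

/-- The resolvent functional. -/
def Fr {n : Type*} [Fintype n] (W : Matrix n n ℂ) (p q : n → ℝ) (t : ℝ) : ℝ :=
  ∑ j, ∑ i, Complex.normSq (W j i) * (p i ^ 2 / (q j + t * p i))

/-- The integrated resolvent functional. -/
def Gr {n : Type*} [Fintype n] (W : Matrix n n ℂ) (p q : n → ℝ) (t : ℝ) : ℝ :=
  ∑ j, ∑ i, Complex.normSq (W j i) * (p i * (Real.log (q j + t * p i) - Real.log (q j)))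

lemma Phi_le {n : Type*} [Fintype n] [DecidableEq n] (U V : Matrix n n ℂ) (p q : n → ℝ)
    (hU : Uᴴ * U = 1) (hV : Vᴴ * V = 1) (hp : ∀ i, 0 ≤ p i) (hq : ∀ i, 0 < q i)
    {t : ℝ} (ht : 0 ≤ t) (Z : Matrix n n ℂ) :
    Phi (U * diagonal (fun i => (p i : ℂ)) * Uᴴ) (V * diagonal (fun i => (q i : ℂ)) * Vᴴ) t Z
     ≤ Fr (Vᴴ * U) p q t := by
  have hU' : U * Uᴴ = 1 := mul_eq_one_comm.mp hU
  have hV' : V * Vᴴ = 1 := mul_eq_one_comm.mp hV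
  have hZ : Z = V * (Vᴴ * Z * U) * Uᴴ := by
    have : V * (Vᴴ * Z * U) * Uᴴ = (V * Vᴴ) * Z * (U * Uᴴ) := by
      simp only [Matrix.mul_assoc]
    rw [this, hU', hV', Matrix.one_mul, Matrix.mul_one]
  rw [hZ, Phi_diag U V p q hU hV]
  unfold Fr
  refine Finset.sum_le_sum fun j _ => Finset.sum_le_sum fun i _ => ?_
  have hc : 0 < q j + t * p i := by have := mul_nonneg ht (hp i); have := hq j; linarith
  generalize (Vᴴ * U) j i = w
  generalize (Vᴴ * Z * U) j i = y
  generalize q j + t * p i = c at hc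
  generalize p i = r
  rw [← mul_div_assoc, le_div_iff₀ hc]
  simp only [Complex.normSq_apply, Complex.star_def, Complex.mul_re, Complex.conj_re,
    Complex.conj_im]
  nlinarith [sq_nonneg (c * y.re - r * w.re), sq_nonneg (c * y.im - r * w.im)]

lemma exists_Phi_eq {n : Type*} [Fintype n] [DecidableEq n] (U V : Matrix n n ℂ) (p q : n → ℝ)
    (hU : Uᴴ * U = 1) (hV : Vᴴ * V = 1) (hp : ∀ i, 0 ≤ p i) (hq : ∀ i, 0 < q i)
    {t : ℝ} (ht : 0 ≤ t) : ∃ Z : Matrix n n ℂ,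
    Phi (U * diagonal (fun i => (p i : ℂ)) * Uᴴ) (V * diagonal (fun i => (q i : ℂ)) * Vᴴ) t Z
     = Fr (Vᴴ * U) p q t := by
  refine ⟨V * (Matrix.of fun j i => ((p i / (q j + t * p i) : ℝ) : ℂ) * (Vᴴ * U) j i) * Uᴴ, ?_⟩
  rw [Phi_diag U V p q hU hV]
  unfold Fr
  refine Finset.sum_congr rfl fun j _ => Finset.sum_congr rfl fun i _ => ?_
  have hc : 0 < q j + t * p i := by have := mul_nonneg ht (hp i); have := hq j; linarith
  rw [Matrix.of_apply]
  generalize (Vᴴ * U) j i = w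
  generalize q j + t * p i = c at hc
  generalize p i = r
  rw [Complex.normSq_mul, Complex.normSq_ofReal]
  simp only [Complex.normSq_apply, Complex.star_def, Complex.mul_re, Complex.conj_re,
    Complex.conj_im, Complex.mul_im, Complex.ofReal_re, Complex.ofReal_im]
  field_simp
  ring

lemma hasDerivAt_Gr {n : Type*} [Fintype n] (W : Matrix n n ℂ) (p q : n → ℝ)
    (hp : ∀ i, 0 ≤ p i) (hq : ∀ i, 0 < q i) {t : ℝ} (ht : 0 ≤ t) :
    HasDerivAt (Gr W p q) (Fr W p q t) t := by
  unfold Gr Fr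
  refine HasDerivAt.fun_sum fun j _ => HasDerivAt.fun_sum fun i _ => ?_
  have hc : 0 < q j + t * p i := by have := mul_nonneg ht (hp i); have := hq j; linarith
  have h1 : HasDerivAt (fun t => q j + t * p i) (p i) t := by
    simpa using ((hasDerivAt_id t).mul_const (p i)).const_add (q j)
  have h2 := (((h1.log hc.ne').sub_const (Real.log (q j))).const_mul (p i)).const_mul
    (Complex.normSq (W j i))
  have h3 : Complex.normSq (W j i) * (p i ^ 2 / (q j + t * p i))
      = Complex.normSq (W j i) * (p i * (p i / (q j + t * p i))) := by
    rw [sq, mul_div_assoc]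
  rw [h3]
  exact h2

lemma Gr_zero {n : Type*} [Fintype n] (W : Matrix n n ℂ) (p q : n → ℝ) : Gr W p q 0 = 0 := by
  simp [Gr]

/-- Relative entropy in terms of eigenvalues. -/
def Dr {n : Type*} [Fintype n] (W : Matrix n n ℂ) (p q : n → ℝ) : ℝ :=
  ∑ j, ∑ i, Complex.normSq (W j i) * (p i * (Real.log (p i) - Real.log (q j)))

lemma tendsto_mul_log (p : ℝ) {ι : Type*} {l : Filter ι} {f : ι → ℝ} (hf : Tendsto f l (𝓝 0)) :
    Tendsto (fun x => p * Real.log (p + f x)) l (𝓝 (p * Real.log p)) := by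
  by_cases h : p = 0
  · simpa [h] using tendsto_const_nhds
  · refine Tendsto.const_mul p ?_
    have : Tendsto (fun x => p + f x) l (𝓝 p) := by simpa using hf.const_add p
    exact (Real.continuousAt_log h).tendsto.comp this

lemma sum_normSq {n : Type*} [Fintype n] [DecidableEq n] (W : Matrix n n ℂ) (hW : Wᴴ * W = 1)
    (i : n) : ∑ j, Complex.normSq (W j i) = 1 := by
  have h := congrArg Complex.re (congrFun (congrFun hW i) i)
  rw [Matrix.mul_apply, Complex.re_sum, Matrix.one_apply_eq, Complex.one_re] at h
  rw [← h]
  refine Finset.sum_congr rfl fun j _ => ?_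
  rw [conjTranspose_apply, Complex.star_def, mul_comm, Complex.mul_conj, Complex.ofReal_re]

lemma sum_W {n : Type*} [Fintype n] [DecidableEq n] (W : Matrix n n ℂ) (hW : Wᴴ * W = 1)
    (f : n → ℝ) : ∑ j, ∑ i, Complex.normSq (W j i) * f i = ∑ i, f i := by
  rw [Finset.sum_comm]
  refine Finset.sum_congr rfl fun i _ => ?_
  rw [← Finset.sum_mul, sum_normSq W hW, one_mul]

lemma tendsto_Gr {n : Type*} [Fintype n] [DecidableEq n] (W : Matrix n n ℂ) (hW : Wᴴ * W = 1)
    (p q : n → ℝ) (hp : ∀ i, 0 ≤ p i) (hq : ∀ i, 0 < q i) :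
    Tendsto (fun t => Gr W p q t - Real.log t * ∑ i, p i) atTop (𝓝 (Dr W p q)) := by
  have key : Tendsto (fun t : ℝ => ∑ j, ∑ i, Complex.normSq (W j i) *
      (p i * Real.log (p i + q j / t) - p i * Real.log (q j))) atTop (𝓝 (Dr W p q)) := by
    unfold Dr
    refine tendsto_finsetSum _ fun j _ => tendsto_finsetSum _ fun i _ => ?_
    rw [mul_sub]
    exact ((tendsto_mul_log (p i) (tendsto_const_nhds.div_atTop tendsto_id)).sub_const _).const_mul _
  refine key.congr' ?_
  filter_upwards [eventually_gt_atTop 0] with t ht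
  rw [Finset.mul_sum, ← sum_W W hW (fun i => Real.log t * p i)]
  unfold Gr
  simp only [← Finset.sum_sub_distrib]
  refine Finset.sum_congr rfl fun j _ => Finset.sum_congr rfl fun i _ => ?_
  have hc : 0 < q j + t * p i := by have := mul_nonneg ht.le (hp i); have := hq j; linarith
  have : p i + q j / t = (q j + t * p i) / t := by field_simp; ring
  rw [this, Real.log_div hc.ne' ht.ne']
  ring

lemma unit_mul {k : Type*} [Fintype k] [DecidableEq k] (U V : Matrix k k ℂ) (hU : Uᴴ * U = 1)
    (hV : Vᴴ * V = 1) : (Vᴴ * U)ᴴ * (Vᴴ * U) = 1 := by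
  have hV2 : V * Vᴴ = 1 := mul_eq_one_comm.mp hV
  have : (Vᴴ * U)ᴴ * (Vᴴ * U) = Uᴴ * (V * Vᴴ) * U := by
    simp only [conjTranspose_mul, conjTranspose_conjTranspose, Matrix.mul_assoc]
  rw [this, hV2, Matrix.mul_one, hU]

lemma Dr_mono {n m : Type*} [Fintype n] [DecidableEq n] [Fintype m] [DecidableEq m]
    (U V : Matrix n n ℂ) (p q : n → ℝ) (U' V' : Matrix m m ℂ) (p' q' : m → ℝ)
    (hU : Uᴴ * U = 1) (hV : Vᴴ * V = 1) (hp : ∀ i, 0 ≤ p i) (hq : ∀ i, 0 < q i)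
    (hU' : U'ᴴ * U' = 1) (hV' : V'ᴴ * V' = 1) (hp' : ∀ i, 0 ≤ p' i) (hq' : ∀ i, 0 < q' i)
    (hs : ∑ i, p' i = ∑ i, p i) (L : Matrix m m ℂ → Matrix n n ℂ)
    (hL : ∀ t Z,
      Phi (U' * diagonal (fun i => (p' i : ℂ)) * U'ᴴ) (V' * diagonal (fun i => (q' i : ℂ)) * V'ᴴ) t Z
      = Phi (U * diagonal (fun i => (p i : ℂ)) * Uᴴ) (V * diagonal (fun i => (q i : ℂ)) * Vᴴ) t
        (L Z)) :
    Dr (V'ᴴ * U') p' q' ≤ Dr (Vᴴ * U) p q := by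
  have hF : ∀ t, 0 ≤ t → Fr (V'ᴴ * U') p' q' t ≤ Fr (Vᴴ * U) p q t := by
    intro t ht
    obtain ⟨Z, hZ⟩ := exists_Phi_eq U' V' p' q' hU' hV' hp' hq' ht
    rw [← hZ, hL]
    exact Phi_le U V p q hU hV hp hq ht _
  have hG : ∀ t, 0 ≤ t → Gr (V'ᴴ * U') p' q' t ≤ Gr (Vᴴ * U) p q t := by
    have hd : ∀ t, 0 ≤ t → HasDerivAt (fun t => Gr (Vᴴ * U) p q t - Gr (V'ᴴ * U') p' q' t)
        (Fr (Vᴴ * U) p q t - Fr (V'ᴴ * U') p' q' t) t := fun t ht =>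
      (hasDerivAt_Gr _ p q hp hq ht).sub (hasDerivAt_Gr _ p' q' hp' hq' ht)
    have hm : MonotoneOn (fun t => Gr (Vᴴ * U) p q t - Gr (V'ᴴ * U') p' q' t) (Set.Ici 0) := by
      refine monotoneOn_of_deriv_nonneg (convex_Ici 0)
        (fun t ht => (hd t ht).continuousAt.continuousWithinAt) ?_ ?_
      · intro t ht
        rw [interior_Ici] at ht
        exact (hd t (le_of_lt ht)).differentiableAt.differentiableWithinAt
      · intro t ht
        rw [interior_Ici] at ht
        rw [(hd t (le_of_lt ht)).deriv]
        exact sub_nonneg.mpr (hF t (le_of_lt ht))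
    intro t ht
    have := hm (Set.mem_Ici.mpr le_rfl) (Set.mem_Ici.mpr ht) ht
    simp only [Gr_zero] at this
    linarith
  refine le_of_tendsto_of_tendsto (tendsto_Gr _ (unit_mul U' V' hU' hV') p' q' hp' hq')
    (tendsto_Gr _ (unit_mul U V hU hV) p q hp hq) ?_
  filter_upwards [eventually_ge_atTop 0] with t ht
  rw [hs]
  exact sub_le_sub_right (hG t ht) _

/-- Partial trace over `C` along an identification `e : n ≃ X × C`. -/
def trC {n X C : Type*} [Fintype C] (e : n ≃ X × C) (τ : Matrix n n ℂ) : Matrix X X ℂ :=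
  fun x y => ∑ c, τ (e.symm (x, c)) (e.symm (y, c))

lemma unit_kron {n X C : Type*} [Fintype n] [DecidableEq n] [Fintype X] [DecidableEq X]
    [Fintype C] [DecidableEq C] (e : n ≃ X × C) (R : Matrix X X ℂ) (hR : Rᴴ * R = 1) :
    ((R ⊗ₖ (1 : Matrix C C ℂ)).submatrix e e)ᴴ * (R ⊗ₖ (1 : Matrix C C ℂ)).submatrix e e
      = 1 := by
  rw [conjTranspose_submatrix, submatrix_mul_equiv, conjTranspose_kronecker, ← mul_kronecker_mul,
    hR, conjTranspose_one, Matrix.one_mul, one_kronecker_one, submatrix_one_equiv]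

lemma Dr_eq {n X C : Type*} [Fintype n] [DecidableEq n] [Fintype X] [DecidableEq X]
    [Fintype C] [DecidableEq C] (e : n ≃ X × C) (U : Matrix n n ℂ) (p : n → ℝ)
    (R : Matrix X X ℂ) (q : X → ℝ) (hU : Uᴴ * U = 1) (hR : Rᴴ * R = 1)
    (hτ : trC e (U * diagonal (fun i => (p i : ℂ)) * Uᴴ)
      = R * diagonal (fun i => (q i : ℂ)) * Rᴴ) (ε : ℝ) :
    Dr (((R ⊗ₖ (1 : Matrix C C ℂ)).submatrix e e)ᴴ * U) p (fun j => q (e j).1 + ε)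
      = ∑ i, p i * Real.log (p i) - ∑ x, q x * Real.log (q x + ε) := by
  have hV : ((R ⊗ₖ (1 : Matrix C C ℂ)).submatrix e e)ᴴ * (R ⊗ₖ (1 : Matrix C C ℂ)).submatrix e e
      = 1 := unit_kron e R hR
  set V := (R ⊗ₖ (1 : Matrix C C ℂ)).submatrix e e with hVdef
  set τ := U * diagonal (fun i => (p i : ℂ)) * Uᴴ with hτdef
  have hW : (Vᴴ * U)ᴴ * (Vᴴ * U) = 1 := by
    have hV2 : V * Vᴴ = 1 := mul_eq_one_comm.mp hV
    have : (Vᴴ * U)ᴴ * (Vᴴ * U) = Uᴴ * (V * Vᴴ) * U := by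
      simp only [conjTranspose_mul, conjTranspose_conjTranspose, Matrix.mul_assoc]
    rw [this, hV2, Matrix.mul_one, hU]
  have h1 : ∀ j, ∑ i, Complex.normSq ((Vᴴ * U) j i) * p i = ((Vᴴ * τ * V) j j).re := by
    intro j
    have : Vᴴ * τ * V = (Vᴴ * U) * diagonal (fun i => (p i : ℂ)) * (Vᴴ * U)ᴴ := by
      simp only [hτdef, conjTranspose_mul, conjTranspose_conjTranspose, Matrix.mul_assoc]
    rw [this, Matrix.mul_apply, Complex.re_sum]
    refine Finset.sum_congr rfl fun i _ => ?_
    rw [mul_diagonal, conjTranspose_apply, Complex.star_def, mul_right_comm, Complex.mul_conj,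
      ← Complex.ofReal_mul, Complex.ofReal_re]
  have h2 : ∀ x, ∑ c, (Vᴴ * τ * V) (e.symm (x, c)) (e.symm (x, c)) = (q x : ℂ) := by
    intro x
    have hq : Rᴴ * trC e τ * R = diagonal (fun i => (q i : ℂ)) := by
      rw [hτ]
      have : Rᴴ * (R * diagonal (fun i => (q i : ℂ)) * Rᴴ) * R
        = (Rᴴ * R) * diagonal (fun i => (q i : ℂ)) * (Rᴴ * R) := by
        simp only [Matrix.mul_assoc]
      rw [this, hR, Matrix.one_mul, Matrix.mul_one]
    have hq2 := congrFun (congrFun hq x) x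
    rw [diagonal_apply_eq] at hq2
    rw [← hq2]
    have ent : ∀ c, (Vᴴ * τ * V) (e.symm (x, c)) (e.symm (x, c))
        = ∑ y, ∑ z, star (R z x) * τ (e.symm (z, c)) (e.symm (y, c)) * R y x := by
      intro c
      rw [Matrix.mul_apply, ← e.symm.sum_comp, Fintype.sum_prod_type]
      refine Finset.sum_congr rfl fun y _ => ?_
      rw [Finset.sum_eq_single c]
      · rw [Matrix.mul_apply, ← e.symm.sum_comp, Fintype.sum_prod_type, Finset.sum_mul]
        refine Finset.sum_congr rfl fun z _ => ?_
        rw [Finset.sum_eq_single c]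
        · simp [hVdef, conjTranspose_apply, kroneckerMap_apply]
        · intro b _ hb
          simp [hVdef, conjTranspose_apply, kroneckerMap_apply, hb]
        · simp
      · intro b _ hb
        simp [hVdef, kroneckerMap_apply, hb]
      · simp
    simp only [ent, Matrix.mul_apply, trC, conjTranspose_apply, Finset.sum_mul, Finset.mul_sum]
    rw [Finset.sum_comm]
    refine Finset.sum_congr rfl fun y _ => ?_
    rw [Finset.sum_comm]
  unfold Dr
  simp only [mul_sub, Finset.sum_sub_distrib]
  congr 1
  · exact sum_W _ hW (fun i => p i * Real.log (p i))
  · simp only [← mul_assoc, ← Finset.sum_mul, h1]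
    rw [← e.symm.sum_comp, Fintype.sum_prod_type]
    refine Finset.sum_congr rfl fun x _ => ?_
    simp only [Equiv.apply_symm_apply]
    rw [← Finset.sum_mul, ← Complex.re_sum, h2, Complex.ofReal_re]

lemma sigma_eq {n X C : Type*} [Fintype n] [DecidableEq n] [Fintype X] [DecidableEq X]
    [Fintype C] [DecidableEq C] (e : n ≃ X × C)
    (R : Matrix X X ℂ) (q : X → ℝ) (hR : Rᴴ * R = 1) (ε : ℝ) :
    (R ⊗ₖ (1 : Matrix C C ℂ)).submatrix e e *
      diagonal (fun j => ((q (e j).1 + ε : ℝ) : ℂ)) * ((R ⊗ₖ (1 : Matrix C C ℂ)).submatrix e e)ᴴ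
    = ((R * diagonal (fun i => (q i : ℂ)) * Rᴴ + (ε : ℂ) • 1) ⊗ₖ (1 : Matrix C C ℂ)).submatrix
      e e := by
  have hR' : R * Rᴴ = 1 := mul_eq_one_comm.mp hR
  have h1 : diagonal (fun j => ((q (e j).1 + ε : ℝ) : ℂ))
      = ((diagonal (fun x => ((q x + ε : ℝ) : ℂ))) ⊗ₖ (1 : Matrix C C ℂ)).submatrix e e := by
    rw [← diagonal_one, diagonal_kronecker_diagonal, submatrix_diagonal_equiv]
    congr 1
    ext j
    simp
  have h2 : diagonal (fun x => ((q x + ε : ℝ) : ℂ)) = diagonal (fun i => (q i : ℂ)) +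
      (ε : ℂ) • (1 : Matrix X X ℂ) := by
    ext x y
    by_cases h : x = y <;> simp [diagonal, h]
  rw [h1, conjTranspose_submatrix, submatrix_mul_equiv, submatrix_mul_equiv,
    conjTranspose_kronecker, ← mul_kronecker_mul, ← mul_kronecker_mul, conjTranspose_one,
    Matrix.one_mul, Matrix.one_mul, h2, Matrix.mul_add, Matrix.add_mul, Matrix.mul_smul,
    Matrix.smul_mul, Matrix.mul_one, hR']

lemma spec {n : Type*} [Fintype n] [DecidableEq n] {ρ : Matrix n n ℂ} (h : ρ.IsHermitian) :
    ∃ U : Matrix n n ℂ, Uᴴ * U = 1 ∧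
      ρ = U * diagonal (fun i => (h.eigenvalues i : ℂ)) * Uᴴ := by
  refine ⟨h.eigenvectorUnitary, ?_, ?_⟩
  · exact Unitary.coe_star_mul_self h.eigenvectorUnitary
  · have := h.spectral_theorem
    rw [Unitary.conjStarAlgAut_apply] at this
    exact this

lemma vN_eq {n : Type*} [Fintype n] [DecidableEq n] {ρ : Matrix n n ℂ} (h : ρ.IsHermitian) :
    vN ρ = -∑ i, h.eigenvalues i * Real.log (h.eigenvalues i) := by
  unfold vN
  rw [dif_pos h]

variable {A B C : Type*} [Fintype A] [Fintype B] [Fintype C]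
  [DecidableEq A] [DecidableEq B] [DecidableEq C]

lemma trace_ptr (ρ : Matrix (A × B × C) (A × B × C) ℂ) (X : Matrix (B × C) (B × C) ℂ) :
    (ρ * ((1 : Matrix A A ℂ) ⊗ₖ X)).trace = (rBC ρ * X).trace := by
  have ent : ∀ a x, (ρ * ((1 : Matrix A A ℂ) ⊗ₖ X)) (a, x) (a, x)
      = ∑ y, ρ (a, x) (a, y) * X y x := by
    intro a x
    rw [Matrix.mul_apply, Fintype.sum_prod_type, Finset.sum_eq_single a]
    · simp [kroneckerMap_apply]
    · intro b _ hb
      simp [kroneckerMap_apply, hb]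
    · simp
  simp only [Matrix.trace, diag_apply]
  rw [Fintype.sum_prod_type]
  simp only [ent]
  rw [Finset.sum_comm]
  refine Finset.sum_congr rfl fun x _ => ?_
  rw [Finset.sum_comm, Matrix.mul_apply]
  refine Finset.sum_congr rfl fun y _ => ?_
  rw [← Finset.sum_mul]
  rfl

lemma Phi_ptr (ρ σ : Matrix (A × B × C) (A × B × C) ℂ) (t : ℝ) (Z : Matrix (B × C) (B × C) ℂ) :
    Phi (rBC ρ) (rBC σ) t Z = Phi ρ σ t ((1 : Matrix A A ℂ) ⊗ₖ Z) := by
  unfold Phi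
  rw [conjTranspose_kronecker, ← mul_kronecker_mul, ← mul_kronecker_mul, conjTranspose_one,
    Matrix.one_mul, trace_ptr, trace_ptr, trace_ptr]

lemma rBC_posSemidef {ρ : Matrix (A × B × C) (A × B × C) ℂ} (h : ρ.PosSemidef) :
    (rBC ρ).PosSemidef := by
  have : rBC ρ = ∑ a : A, ρ.submatrix (fun x : B × C => (a, x)) (fun x : B × C => (a, x)) := by
    ext x y
    simp [rBC, Matrix.sum_apply]
  rw [this]
  exact posSemidef_sum _ fun a _ => h.submatrix _

lemma rAB_posSemidef {ρ : Matrix (A × B × C) (A × B × C) ℂ} (h : ρ.PosSemidef) :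
    (rAB ρ).PosSemidef := by
  have : rAB ρ = ∑ c : C, ρ.submatrix (fun x : A × B => (x.1, x.2, c))
      (fun x : A × B => (x.1, x.2, c)) := by
    ext x y
    simp [rAB, Matrix.sum_apply]
  rw [this]
  exact posSemidef_sum _ fun a _ => h.submatrix _

lemma rB_posSemidef {ρ : Matrix (A × B × C) (A × B × C) ℂ} (h : ρ.PosSemidef) :
    (rB ρ).PosSemidef := by
  have : rB ρ = ∑ a : A, ∑ c : C, ρ.submatrix (fun x : B => (a, x, c))
      (fun x : B => (a, x, c)) := by
    ext x y
    simp [rB, Matrix.sum_apply]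
  rw [this]
  exact posSemidef_sum _ fun a _ => posSemidef_sum _ fun c _ => h.submatrix _

lemma rBC_sigma (ρ : Matrix (A × B × C) (A × B × C) ℂ) (ε : ℝ) :
    rBC (((rAB ρ + (ε : ℂ) • 1) ⊗ₖ (1 : Matrix C C ℂ)).submatrix (Equiv.prodAssoc A B C).symm
      (Equiv.prodAssoc A B C).symm)
    = ((rB ρ + ((Fintype.card A * ε : ℝ) : ℂ) • 1) ⊗ₖ (1 : Matrix C C ℂ)).submatrix
      (Equiv.refl (B × C)) (Equiv.refl (B × C)) := by
  ext ⟨b, c⟩ ⟨b', c'⟩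
  simp only [rBC, rAB, rB, submatrix_apply, kroneckerMap_apply, Matrix.add_apply,
    Matrix.smul_apply, Equiv.prodAssoc_symm_apply, Equiv.refl_apply]
  by_cases h : b = b' <;> simp [Matrix.one_apply, h, Finset.sum_add_distrib]

/-- Strong subadditivity of the von Neumann entropy. -/
theorem ssa (ρ : Matrix (A × B × C) (A × B × C) ℂ) (hρ : IsDensityMatrix ρ) :
    vN ρ + vN (rB ρ) ≤ vN (rAB ρ) + vN (rBC ρ) := by
  obtain ⟨hpos, htr⟩ := hρ
  have hne : Nonempty A := by
    by_contra h
    rw [not_nonempty_iff] at h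
    simp [Matrix.trace] at htr
  have hcard : (0 : ℝ) < Fintype.card A := by exact_mod_cast Fintype.card_pos
  have hBC := rBC_posSemidef hpos
  have hAB := rAB_posSemidef hpos
  have hB := rB_posSemidef hpos
  rw [vN_eq hpos.1, vN_eq hBC.1, vN_eq hAB.1, vN_eq hB.1]
  obtain ⟨U, hU, eU⟩ := spec hpos.1
  obtain ⟨U', hU', eU'⟩ := spec hBC.1
  obtain ⟨R, hR, eR⟩ := spec hAB.1
  obtain ⟨R', hR', eR'⟩ := spec hB.1
  have hp := hpos.eigenvalues_nonneg
  have hp' := hBC.eigenvalues_nonneg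
  have hq := hAB.eigenvalues_nonneg
  have hq' := hB.eigenvalues_nonneg
  have hs : ∑ i, hBC.1.eigenvalues i = ∑ i, hpos.1.eigenvalues i := by
    have h1 := hpos.1.trace_eq_sum_eigenvalues
    have h2 := hBC.1.trace_eq_sum_eigenvalues
    have h3 := trace_ptr ρ 1
    rw [one_kronecker_one, Matrix.mul_one, Matrix.mul_one, h1, h2] at h3
    exact_mod_cast h3.symm
  generalize hpos.1.eigenvalues = p at *
  generalize hBC.1.eigenvalues = p' at *
  generalize hAB.1.eigenvalues = q at *
  generalize hB.1.eigenvalues = q' at *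
  have tAB : trC (Equiv.prodAssoc A B C).symm ρ = rAB ρ := by
    ext x y
    rfl
  have tB : trC (Equiv.refl (B × C)) (rBC ρ) = rB ρ := by
    ext x y
    simp only [trC, rBC, rB, Equiv.refl_symm, Equiv.refl_apply]
    rw [Finset.sum_comm]
  have main : ∀ ε : ℝ, 0 < ε →
      ∑ i, p' i * Real.log (p' i) - ∑ x, q' x * Real.log (q' x + Fintype.card A * ε)
      ≤ ∑ i, p i * Real.log (p i) - ∑ x, q x * Real.log (q x + ε) := by
    intro ε hε
    rw [← Dr_eq (Equiv.prodAssoc A B C).symm U p R q hU hR (by rw [← eU, ← eR, tAB]) ε,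
      ← Dr_eq (Equiv.refl (B × C)) U' p' R' q' hU' hR' (by rw [← eU', ← eR', tB])
        (Fintype.card A * ε)]
    refine Dr_mono U _ p _ U' _ p' _ hU (unit_kron _ R hR) hp ?_ hU' (unit_kron _ R' hR') hp' ?_ hs
      (fun Z => (1 : Matrix A A ℂ) ⊗ₖ Z) ?_
    · intro j
      have := hq ((Equiv.prodAssoc A B C).symm j).1
      exact add_pos_of_nonneg_of_pos this hε
    · intro j
      have := hq' ((Equiv.refl (B × C)) j).1
      exact add_pos_of_nonneg_of_pos this (mul_pos hcard hε)
    · intro t Z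
      rw [sigma_eq _ R q hR ε, sigma_eq _ R' q' hR' (Fintype.card A * ε), ← eU, ← eU', ← eR, ← eR',
        ← rBC_sigma, Phi_ptr]
  have h0 : Tendsto (fun ε : ℝ => ε) (𝓝[>] 0) (𝓝 0) := tendsto_nhdsWithin_of_tendsto_nhds tendsto_id
  have h0' : Tendsto (fun ε : ℝ => Fintype.card A * ε) (𝓝[>] 0) (𝓝 0) := by
    simpa using h0.const_mul (Fintype.card A : ℝ)
  have lim := le_of_tendsto_of_tendsto
    ((tendsto_finsetSum Finset.univ fun x _ => tendsto_mul_log (q' x) h0').const_sub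
      (∑ i, p' i * Real.log (p' i)))
    ((tendsto_finsetSum Finset.univ fun x _ => tendsto_mul_log (q x) h0).const_sub
      (∑ i, p i * Real.log (p i)))
    (eventually_nhdsWithin_of_forall fun ε hε => main ε hε)
  linarith

end SSA

/-- For any tripartite density matrix `ρ_ABC`, the convoluted metric satisfies the triangle
inequality `M_AB + M_BC ≥ M_AC`, where for each pair of subsystems `X, Y` (with `Z` the
remaining one) `M_XY = 2S(ρ_XY) + S(ρ_XZ) + S(ρ_YZ) − S(ρ_X) − S(ρ_Y) − 2S(ρ_ABC)`. -/
theorem convoluted_metric_triangle_inequality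
    {A B C : Type*} [Fintype A] [Fintype B] [Fintype C]
    [DecidableEq A] [DecidableEq B] [DecidableEq C]
    (ρ : Matrix (A × B × C) (A × B × C) ℂ) (hρ : IsDensityMatrix ρ) :
    (2 * vN (rAB ρ) + vN (rAC ρ) + vN (rBC ρ) - vN (rA ρ) - vN (rB ρ) - 2 * vN ρ) +
      (2 * vN (rBC ρ) + vN (rAB ρ) + vN (rAC ρ) - vN (rB ρ) - vN (rC ρ) - 2 * vN ρ) ≥
      2 * vN (rAC ρ) + vN (rAB ρ) + vN (rBC ρ) - vN (rA ρ) - vN (rC ρ) - 2 * vN ρ := by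
  have h := SSA.ssa ρ hρ
  linarith
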